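/- Let Ω ⊂ ℝᴺ be bounded and open, 0 < s' < s < 1, and let (Φ_{x,y}) satisfy the uniform index condition 1 < φ⁻ ≤ tφ_{x,y}(t)/Φ_{x,y}(t) ≤ φ⁺ < ∞ together with sup_{(x,y)} Φ_{x,y}(1) < ∞ and inf_{(x,y)} Φ_{x,y}(1) > 0. Then W^sL_{Φ_{x,y}}(Ω) is continuously embedded in the classical fractional Sobolev space W^{s',q}(Ω) for every q ∈ [1, φ⁻]. -/

import Mathlib

open Real MeasureTheory ENNReal

/-- The Gagliardo-type modular. -/
noncomputable def fracModular (N : ℕ)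
    (Φ : EuclideanSpace ℝ (Fin N) → EuclideanSpace ℝ (Fin N) → ℝ → ℝ) (s : ℝ)
    (Ω : Set (EuclideanSpace ℝ (Fin N))) (u : EuclideanSpace ℝ (Fin N) → ℝ) : ℝ≥0∞ :=
  ∫⁻ x in Ω, ∫⁻ y in Ω,
    ENNReal.ofReal (Φ x y (|u x - u y| / ‖x - y‖ ^ s) / ‖x - y‖ ^ (N : ℝ))

/-- The Gagliardo–Luxemburg seminorm `[u]_{s,Φ}`. -/
noncomputable def fracSeminorm (N : ℕ)
    (Φ : EuclideanSpace ℝ (Fin N) → EuclideanSpace ℝ (Fin N) → ℝ → ℝ) (s : ℝ)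
    (Ω : Set (EuclideanSpace ℝ (Fin N))) (u : EuclideanSpace ℝ (Fin N) → ℝ) : ℝ :=
  sInf {l : ℝ | 0 < l ∧ fracModular N Φ s Ω (fun x => u x / l) ≤ 1}

/-- The Luxemburg norm `‖u‖_{Φ̂_x}` on the Musielak space `L_{Φ̂_x}(Ω)`, `Φ̂_x = Φ_{x,x}`. -/
noncomputable def luxNorm (N : ℕ)
    (Φ : EuclideanSpace ℝ (Fin N) → EuclideanSpace ℝ (Fin N) → ℝ → ℝ)
    (Ω : Set (EuclideanSpace ℝ (Fin N))) (u : EuclideanSpace ℝ (Fin N) → ℝ) : ℝ :=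
  sInf {l : ℝ | 0 < l ∧ (∫⁻ x in Ω, ENNReal.ofReal (Φ x x (|u x| / l))) ≤ 1}

/-- Membership in the fractional Musielak–Sobolev space `W^sL_{Φ_{x,y}}(Ω)`. -/
def memW (N : ℕ)
    (Φ : EuclideanSpace ℝ (Fin N) → EuclideanSpace ℝ (Fin N) → ℝ → ℝ) (s : ℝ)
    (Ω : Set (EuclideanSpace ℝ (Fin N))) (u : EuclideanSpace ℝ (Fin N) → ℝ) : Prop :=
  Measurable u ∧
    (∃ l : ℝ, 0 < l ∧ (∫⁻ x in Ω, ENNReal.ofReal (Φ x x (|u x| / l))) < ⊤) ∧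
    (∃ l : ℝ, 0 < l ∧ fracModular N Φ s Ω (fun x => u x / l) < ⊤)

/-- The classical fractional Sobolev `W^{s',q}` norm (as an extended real). -/
noncomputable def classicalFracNorm (N : ℕ) (s' q : ℝ)
    (Ω : Set (EuclideanSpace ℝ (Fin N))) (u : EuclideanSpace ℝ (Fin N) → ℝ) : ℝ≥0∞ :=
  (∫⁻ x in Ω, ENNReal.ofReal (|u x| ^ q)) ^ (1 / q) +
    (∫⁻ x in Ω, ∫⁻ y in Ω,
        ENNReal.ofReal (|u x - u y| ^ q / ‖x - y‖ ^ ((N : ℝ) + s' * q))) ^ (1 / q)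

lemma ofReal_le_mul_sInf {S : Set ℝ} (hS : S.Nonempty) {C : ℝ} (hC : 0 < C) {X : ℝ≥0∞}
    (hS0 : ∀ l ∈ S, 0 < l) (hX : ∀ l ∈ S, X ≤ ENNReal.ofReal (C * l)) :
    X ≤ ENNReal.ofReal (C * sInf S) := by
  obtain ⟨l₀, hl₀⟩ := hS
  have hXtop : X ≠ ⊤ := ne_top_of_le_ne_top ofReal_ne_top (hX l₀ hl₀)
  rw [← ENNReal.ofReal_toReal hXtop]
  refine ENNReal.ofReal_le_ofReal ?_
  rw [← div_le_iff₀' hC]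
  refine le_csInf ⟨l₀, hl₀⟩ fun l hl => ?_
  rw [div_le_iff₀' hC]
  exact ENNReal.toReal_le_of_le_ofReal (mul_pos hC (hS0 l hl)).le (hX l hl)

lemma rpow_inv_le_of_le_rpow_mul {I : ℝ≥0∞} {q l K : ℝ} (hq : 1 ≤ q) (hl : 0 < l) (hK : 0 ≤ K)
    (h : I ≤ ENNReal.ofReal (l ^ q * K)) :
    I ^ (1 / q) ≤ ENNReal.ofReal (K ^ (1 / q) * l) := by
  have hq0 : 0 < q := by linarith
  calc I ^ (1 / q) ≤ (ENNReal.ofReal (l ^ q * K)) ^ (1 / q) := by gcongr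
    _ = ENNReal.ofReal ((l ^ q * K) ^ (1 / q)) :=
        ENNReal.ofReal_rpow_of_nonneg (by positivity) (by positivity)
    _ = ENNReal.ofReal (K ^ (1 / q) * l) := by
        rw [Real.mul_rpow (by positivity) hK, ← Real.rpow_mul hl.le,
          mul_one_div_cancel hq0.ne', Real.rpow_one, mul_comm]

section Primitive

variable {f F : ℝ → ℝ} {p : ℝ}

lemma primitive_pos (hf : StrictMono f) (hf0 : f 0 = 0) (hc : Continuous f)
    (hF : ∀ t, F t = ∫ τ in (0:ℝ)..t, f τ) {t : ℝ} (ht : 0 < t) : 0 < F t := by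
  rw [hF]
  refine intervalIntegral.intervalIntegral_pos_of_pos_on (hc.intervalIntegrable _ _) ?_ ht
  intro x hx
  rw [← hf0]
  exact hf hx.1

lemma primitive_growth (hf : StrictMono f) (hf0 : f 0 = 0) (hc : Continuous f)
    (hF : ∀ t, F t = ∫ τ in (0:ℝ)..t, f τ)
    (hp : ∀ t, 0 < t → p ≤ t * f t / F t) {a b : ℝ} (ha : 0 < a) (hab : a ≤ b) :
    F a * b ^ p ≤ F b * a ^ p := by
  have hderiv : ∀ t, HasDerivAt F (f t) t := fun t => by
    rw [show F = fun t => ∫ τ in (0:ℝ)..t, f τ from funext hF]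
    exact hc.integral_hasStrictDerivAt 0 t |>.hasDerivAt
  have hd : ∀ t, 0 < t → HasDerivAt (fun t => F t * t ^ (-p))
      (f t * t ^ (-p) + F t * (-p * t ^ (-p - 1))) t := fun t ht =>
    (hderiv t).mul (Real.hasDerivAt_rpow_const (Or.inl ht.ne'))
  have hmono : MonotoneOn (fun t => F t * t ^ (-p)) (Set.Ioi 0) := by
    refine monotoneOn_of_deriv_nonneg (convex_Ioi 0)
      (fun t ht => (hd t ht).continuousAt.continuousWithinAt) ?_ ?_
    · intro t ht
      rw [interior_Ioi] at ht
      exact (hd t ht).differentiableAt.differentiableWithinAt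
    · intro t ht
      rw [interior_Ioi] at ht
      have ht : 0 < t := ht
      have h1 := hp t ht
      rw [le_div_iff₀ (primitive_pos hf hf0 hc hF ht)] at h1
      rw [(hd t ht).deriv, Real.rpow_sub_one ht.ne']
      have : f t * t ^ (-p) + F t * (-p * (t ^ (-p) / t)) =
          (t ^ (-p) / t) * (t * f t - p * F t) := by
        field_simp
        ring
      rw [this]
      exact mul_nonneg (by positivity) (by linarith)
  have hb : 0 < b := ha.trans_le hab
  have h := hmono (Set.mem_Ioi.2 ha) (Set.mem_Ioi.2 hb) hab
  simp only [Real.rpow_neg ha.le, Real.rpow_neg hb.le, ← div_eq_mul_inv] at h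
  rwa [div_le_div_iff₀ (by positivity) (by positivity)] at h

lemma primitive_nonneg (hf : StrictMono f) (hf0 : f 0 = 0) (hc : Continuous f)
    (hF : ∀ t, F t = ∫ τ in (0:ℝ)..t, f τ) {t : ℝ} (ht : 0 ≤ t) : 0 ≤ F t := by
  rcases ht.eq_or_lt with rfl | ht
  · simp [hF]
  · exact (primitive_pos hf hf0 hc hF ht).le

lemma primitive_div_le (hf : StrictMono f) (hf0 : f 0 = 0) (hc : Continuous f)
    (hF : ∀ t, F t = ∫ τ in (0:ℝ)..t, f τ)
    (hp : ∀ t, 0 < t → 1 ≤ t * f t / F t) {t k : ℝ} (ht : 0 ≤ t) (hk : 1 ≤ k) :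
    F (t / k) ≤ k⁻¹ * F t := by
  have hk0 : 0 < k := by linarith
  rcases ht.eq_or_lt with rfl | ht
  · simp [hF]
  · have h := primitive_growth hf hf0 hc hF hp (div_pos ht hk0) (div_le_self ht.le hk)
    simp only [Real.rpow_one] at h
    rw [← mul_le_mul_iff_left₀ ht]
    calc _ ≤ _ := h
      _ = _ := by field_simp

lemma rpow_le_one_add_primitive (hf : StrictMono f) (hf0 : f 0 = 0) (hc : Continuous f)
    (hF : ∀ t, F t = ∫ τ in (0:ℝ)..t, f τ) (hp0 : 0 ≤ p)
    (hp : ∀ t, 0 < t → p ≤ t * f t / F t) {c : ℝ} (hc0 : 0 < c) (hcF : c ≤ F 1)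
    {t : ℝ} (ht : 0 ≤ t) : t ^ p ≤ 1 + c⁻¹ * F t := by
  have hnn := primitive_nonneg hf hf0 hc hF ht
  rcases le_total t 1 with h | h
  · have := Real.rpow_le_one ht h hp0
    have : 0 ≤ c⁻¹ * F t := by positivity
    linarith
  · have h1 := primitive_growth hf hf0 hc hF hp one_pos h
    rw [Real.one_rpow, mul_one] at h1
    have h2 : c * t ^ p ≤ F t := le_trans (by gcongr) h1
    have : t ^ p ≤ c⁻¹ * F t := by
      rw [inv_mul_eq_div, le_div_iff₀' hc0]
      exact h2
    linarith

end Primitive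

lemma integrableOn_ball_norm_rpow_sub (N : ℕ) {a D : ℝ} (ha : 0 < a) (hD : 0 < D) :
    IntegrableOn (fun z : EuclideanSpace ℝ (Fin N) => ‖z‖ ^ (a - N)) (Metric.ball 0 D) := by
  rcases Nat.eq_zero_or_pos N with rfl | hN
  · have : (fun z : EuclideanSpace ℝ (Fin 0) => ‖z‖ ^ (a - (0 : ℕ))) = 0 := by
      ext z
      simp [Subsingleton.elim z 0, Real.zero_rpow ha.ne']
    rw [this]
    exact integrableOn_zero
  · have : Nonempty (Fin N) := ⟨⟨0, hN⟩⟩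
    refine (integrableOn_fun_norm_addHaar volume (f := fun r : ℝ => r ^ (a - N))).2 ?_
    have h := (intervalIntegral.integrableOn_Ioo_rpow_iff (s := a - 1) hD).2 (by linarith)
    refine h.congr_fun (fun y hy => ?_) measurableSet_Ioo
    have hy : 0 < y := hy.1
    simp only [finrank_euclideanSpace, Fintype.card_fin, smul_eq_mul]
    rw [← Real.rpow_natCast, ← Real.rpow_add hy, Nat.cast_sub hN]
    congr 1
    push_cast
    ring

lemma exists_setLIntegral_kernel_le (N : ℕ) {Ω : Set (EuclideanSpace ℝ (Fin N))} {a D : ℝ}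
    (ha : 0 < a) (hD : 0 < D) (hΩ : ∀ x ∈ Ω, ∀ y ∈ Ω, ‖x - y‖ < D) :
    ∃ K : ℝ, 0 ≤ K ∧ ∀ x ∈ Ω,
      ∫⁻ y in Ω, ENNReal.ofReal (‖x - y‖ ^ (a - N)) ≤ ENNReal.ofReal K := by
  have hint := integrableOn_ball_norm_rpow_sub N ha hD
  set g : EuclideanSpace ℝ (Fin N) → ℝ≥0∞ :=
    (Metric.ball 0 D).indicator fun z => ENNReal.ofReal (‖z‖ ^ (a - N)) with hg
  have hfin : ∫⁻ z, g z ≠ ⊤ := by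
    rw [hg, lintegral_indicator measurableSet_ball]
    exact hint.setLIntegral_lt_top.ne
  refine ⟨(∫⁻ z, g z).toReal, ENNReal.toReal_nonneg, fun x hx => ?_⟩
  rw [ENNReal.ofReal_toReal hfin]
  calc ∫⁻ y in Ω, ENNReal.ofReal (‖x - y‖ ^ (a - N))
      ≤ ∫⁻ y in {y | ‖x - y‖ < D}, ENNReal.ofReal (‖x - y‖ ^ (a - N)) :=
        lintegral_mono_set fun y hy => hΩ x hx y hy
    _ = ∫⁻ y, g (x - y) := by
        rw [← lintegral_indicator (measurableSet_lt (by fun_prop) (by fun_prop))]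
        congr 1
        ext y
        simp [hg, Set.indicator]
    _ = ∫⁻ z, g z := lintegral_sub_left_eq_self g x

section Modulars

variable {N : ℕ} {φ Φ : EuclideanSpace ℝ (Fin N) → EuclideanSpace ℝ (Fin N) → ℝ → ℝ}
  {Ω : Set (EuclideanSpace ℝ (Fin N))} {u : EuclideanSpace ℝ (Fin N) → ℝ}

lemma exists_luxModular_le_one
    (hdiv : ∀ x y t k, 0 ≤ t → 1 ≤ k → Φ x y (t / k) ≤ k⁻¹ * Φ x y t)
    {l : ℝ} (hl : 0 < l) (hfin : ∫⁻ x in Ω, ENNReal.ofReal (Φ x x (|u x| / l)) < ⊤) :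
    ∃ l' : ℝ, 0 < l' ∧ ∫⁻ x in Ω, ENNReal.ofReal (Φ x x (|u x| / l')) ≤ 1 := by
  set M := ∫⁻ x in Ω, ENNReal.ofReal (Φ x x (|u x| / l))
  set k := max 1 M.toReal
  have hk : 1 ≤ k := le_max_left _ _
  have hk0 : 0 < k := by linarith
  refine ⟨l * k, by positivity, ?_⟩
  calc ∫⁻ x in Ω, ENNReal.ofReal (Φ x x (|u x| / (l * k)))
      ≤ ∫⁻ x in Ω, ENNReal.ofReal k⁻¹ * ENNReal.ofReal (Φ x x (|u x| / l)) := by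
        refine lintegral_mono fun x => ?_
        rw [← ENNReal.ofReal_mul (by positivity), ← div_div]
        exact ENNReal.ofReal_le_ofReal (hdiv _ _ _ _ (by positivity) hk)
    _ = ENNReal.ofReal k⁻¹ * M := lintegral_const_mul' _ _ ofReal_ne_top
    _ ≤ ENNReal.ofReal k⁻¹ * ENNReal.ofReal k := by
        gcongr
        exact (ENNReal.le_ofReal_iff_toReal_le hfin.ne hk0.le).2 (le_max_right _ _)
    _ = 1 := by
        rw [← ENNReal.ofReal_mul (by positivity), inv_mul_cancel₀ hk0.ne', ENNReal.ofReal_one]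

lemma exists_fracModular_le_one
    (hdiv : ∀ x y t k, 0 ≤ t → 1 ≤ k → Φ x y (t / k) ≤ k⁻¹ * Φ x y t)
    {s l : ℝ} (hl : 0 < l) (hfin : fracModular N Φ s Ω (fun x => u x / l) < ⊤) :
    ∃ l' : ℝ, 0 < l' ∧ fracModular N Φ s Ω (fun x => u x / l') ≤ 1 := by
  set M := fracModular N Φ s Ω (fun x => u x / l)
  set k := max 1 M.toReal
  have hk : 1 ≤ k := le_max_left _ _
  have hk0 : 0 < k := by linarith
  refine ⟨l * k, by positivity, ?_⟩
  calc fracModular N Φ s Ω (fun x => u x / (l * k))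
      ≤ ∫⁻ x in Ω, ∫⁻ y in Ω, ENNReal.ofReal k⁻¹ *
          ENNReal.ofReal (Φ x y (|u x / l - u y / l| / ‖x - y‖ ^ s) / ‖x - y‖ ^ (N : ℝ)) := by
        refine lintegral_mono fun x => lintegral_mono fun y => ?_
        rw [← ENNReal.ofReal_mul (by positivity), ← mul_div_assoc]
        refine ENNReal.ofReal_le_ofReal ?_
        gcongr
        have : |u x / (l * k) - u y / (l * k)| / ‖x - y‖ ^ s =
            |u x / l - u y / l| / ‖x - y‖ ^ s / k := by
          rw [← div_div, ← div_div, ← sub_div, abs_div, abs_of_pos hk0, div_right_comm]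
        rw [this]
        exact hdiv _ _ _ _ (by positivity) hk
    _ = ENNReal.ofReal k⁻¹ * M := by
        simp_rw [lintegral_const_mul' _ _ ofReal_ne_top]
        rfl
    _ ≤ ENNReal.ofReal k⁻¹ * ENNReal.ofReal k := by
        gcongr
        exact (ENNReal.le_ofReal_iff_toReal_le hfin.ne hk0.le).2 (le_max_right _ _)
    _ = 1 := by
        rw [← ENNReal.ofReal_mul (by positivity), inv_mul_cancel₀ hk0.ne', ENNReal.ofReal_one]

lemma lintegral_rpow_le_of_luxModular_le_one {q c l : ℝ} (hΩ : volume Ω ≠ ⊤)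
    (hc : 0 < c) (hl : 0 < l) (hnn : ∀ x y t, 0 ≤ t → 0 ≤ Φ x y t)
    (hgrow : ∀ x y t, 0 ≤ t → t ^ q ≤ 1 + c⁻¹ * Φ x y t)
    (hle : ∫⁻ x in Ω, ENNReal.ofReal (Φ x x (|u x| / l)) ≤ 1) :
    ∫⁻ x in Ω, ENNReal.ofReal (|u x| ^ q) ≤
      ENNReal.ofReal (l ^ q * ((volume Ω).toReal + c⁻¹)) := by
  calc ∫⁻ x in Ω, ENNReal.ofReal (|u x| ^ q)
      ≤ ∫⁻ x in Ω, ENNReal.ofReal (l ^ q) *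
          (1 + ENNReal.ofReal c⁻¹ * ENNReal.ofReal (Φ x x (|u x| / l))) := by
        refine lintegral_mono fun x => ?_
        have h0 := hnn x x (|u x| / l) (by positivity)
        rw [← ENNReal.ofReal_mul (by positivity), ← ENNReal.ofReal_one,
          ← ENNReal.ofReal_add zero_le_one (by positivity),
          ← ENNReal.ofReal_mul (by positivity)]
        refine ENNReal.ofReal_le_ofReal ?_
        calc |u x| ^ q = l ^ q * (|u x| / l) ^ q := by
              rw [← Real.mul_rpow hl.le (by positivity), mul_div_cancel₀ _ hl.ne']
          _ ≤ _ := by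
              gcongr
              exact hgrow _ _ _ (by positivity)
    _ = ENNReal.ofReal (l ^ q) * (volume Ω + ENNReal.ofReal c⁻¹ *
          ∫⁻ x in Ω, ENNReal.ofReal (Φ x x (|u x| / l))) := by
        rw [lintegral_const_mul' _ _ ofReal_ne_top, lintegral_add_left measurable_const,
          lintegral_const_mul' _ _ ofReal_ne_top, setLIntegral_one]
    _ ≤ ENNReal.ofReal (l ^ q) * (volume Ω + ENNReal.ofReal c⁻¹ * 1) := by gcongr
    _ = _ := by
        rw [ENNReal.ofReal_mul (by positivity), ENNReal.ofReal_add (by positivity) (by positivity),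
          ENNReal.ofReal_toReal hΩ, mul_one]

lemma gagliardo_integrand_le {x y : EuclideanSpace ℝ (Fin N)} {q c l s s' D : ℝ} (hq : 1 ≤ q)
    (hs : s' < s) (hc : 0 < c) (hl : 0 < l) (hD : ‖x - y‖ ≤ D)
    (hnn : ∀ x y t, 0 ≤ t → 0 ≤ Φ x y t)
    (hgrow : ∀ x y t, 0 ≤ t → t ^ q ≤ 1 + c⁻¹ * Φ x y t) :
    |u x - u y| ^ q / ‖x - y‖ ^ ((N : ℝ) + s' * q) ≤
      l ^ q * (‖x - y‖ ^ ((s - s') * q - N) + D ^ ((s - s') * q) * c⁻¹ *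
        (Φ x y (|u x / l - u y / l| / ‖x - y‖ ^ s) / ‖x - y‖ ^ (N : ℝ))) := by
  have hq0 : 0 < q := by linarith
  have hD0 : 0 ≤ D := (norm_nonneg _).trans hD
  set t := |u x / l - u y / l| / ‖x - y‖ ^ s with ht
  have ht0 : 0 ≤ t := by positivity
  have hΦ0 := hnn x y t ht0
  rcases (norm_nonneg (x - y)).eq_or_lt with h | h
  · have hxy : x = y := sub_eq_zero.1 (norm_eq_zero.1 h.symm)
    have : |u x - u y| ^ q = 0 := by rw [hxy, sub_self, abs_zero, Real.zero_rpow hq0.ne']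
    rw [this, zero_div]
    positivity
  · set r := ‖x - y‖
    have hd : |u x - u y| = l * t * r ^ s := by
      rw [ht, ← sub_div, abs_div, abs_of_pos hl]
      field_simp
    have hsplit : r ^ ((s - s') * q - N) = r ^ ((s - s') * q) / r ^ (N : ℝ) :=
      Real.rpow_sub h _ _
    have hpow : (r ^ s) ^ q / r ^ ((N : ℝ) + s' * q) = r ^ ((s - s') * q - N) := by
      rw [← Real.rpow_mul h.le, ← Real.rpow_sub h]
      congr 1
      ring
    calc |u x - u y| ^ q / r ^ ((N : ℝ) + s' * q)
        = l ^ q * (t ^ q * r ^ ((s - s') * q - N)) := by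
          rw [hd, Real.mul_rpow (by positivity) (by positivity), Real.mul_rpow hl.le ht0, ← hpow]
          ring
      _ ≤ l ^ q * ((1 + c⁻¹ * Φ x y t) * r ^ ((s - s') * q - N)) := by
          gcongr
          exact hgrow _ _ _ ht0
      _ = l ^ q * (r ^ ((s - s') * q - N) +
            r ^ ((s - s') * q) * c⁻¹ * (Φ x y t / r ^ (N : ℝ))) := by
          rw [hsplit]
          ring
      _ ≤ _ := by
          have : 0 ≤ (s - s') * q := mul_nonneg (by linarith) hq0.le
          gcongr

lemma lintegral_gagliardo_le_of_fracModular_le_one {q c l s s' D K : ℝ}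
    (hΩm : MeasurableSet Ω) (hΩ : volume Ω ≠ ⊤) (hq : 1 ≤ q) (hs : s' < s) (hc : 0 < c)
    (hl : 0 < l) (hD0 : 0 < D) (hD : ∀ x ∈ Ω, ∀ y ∈ Ω, ‖x - y‖ < D) (hK0 : 0 ≤ K)
    (hK : ∀ x ∈ Ω,
      ∫⁻ y in Ω, ENNReal.ofReal (‖x - y‖ ^ ((s - s') * q - N)) ≤ ENNReal.ofReal K)
    (hnn : ∀ x y t, 0 ≤ t → 0 ≤ Φ x y t)
    (hgrow : ∀ x y t, 0 ≤ t → t ^ q ≤ 1 + c⁻¹ * Φ x y t)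
    (hle : fracModular N Φ s Ω (fun x => u x / l) ≤ 1) :
    ∫⁻ x in Ω, ∫⁻ y in Ω,
        ENNReal.ofReal (|u x - u y| ^ q / ‖x - y‖ ^ ((N : ℝ) + s' * q)) ≤
      ENNReal.ofReal (l ^ q * (K * (volume Ω).toReal + D ^ ((s - s') * q) * c⁻¹)) := by
  set B := D ^ ((s - s') * q) * c⁻¹
  have hB0 : 0 ≤ B := by positivity
  set G : EuclideanSpace ℝ (Fin N) → EuclideanSpace ℝ (Fin N) → ℝ := fun x y =>
    Φ x y (|u x / l - u y / l| / ‖x - y‖ ^ s) / ‖x - y‖ ^ (N : ℝ)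
  have hG0 : ∀ x y, 0 ≤ G x y := fun x y =>
    div_nonneg (hnn _ _ _ (by positivity)) (by positivity)
  have hinner : ∀ x ∈ Ω,
      ∫⁻ y in Ω, ENNReal.ofReal (|u x - u y| ^ q / ‖x - y‖ ^ ((N : ℝ) + s' * q)) ≤
        ENNReal.ofReal (l ^ q) * (ENNReal.ofReal K +
          ENNReal.ofReal B * ∫⁻ y in Ω, ENNReal.ofReal (G x y)) := fun x hx =>
    calc _ ≤ ∫⁻ y in Ω, ENNReal.ofReal (l ^ q) *
            (ENNReal.ofReal (‖x - y‖ ^ ((s - s') * q - N)) +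
              ENNReal.ofReal B * ENNReal.ofReal (G x y)) := by
          refine setLIntegral_mono' hΩm fun y hy => ?_
          have hGxy := hG0 x y
          rw [← ENNReal.ofReal_mul hB0, ← ENNReal.ofReal_add (by positivity) (by positivity),
            ← ENNReal.ofReal_mul (by positivity)]
          exact ENNReal.ofReal_le_ofReal
            (gagliardo_integrand_le hq hs hc hl (hD x hx y hy).le hnn hgrow)
      _ = ENNReal.ofReal (l ^ q) *
            ((∫⁻ y in Ω, ENNReal.ofReal (‖x - y‖ ^ ((s - s') * q - N))) +
              ENNReal.ofReal B * ∫⁻ y in Ω, ENNReal.ofReal (G x y)) := by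
          rw [lintegral_const_mul' _ _ ofReal_ne_top, lintegral_add_left (by fun_prop),
            lintegral_const_mul' _ _ ofReal_ne_top]
      _ ≤ _ := by
          gcongr
          exact hK x hx
  calc _ ≤ ∫⁻ x in Ω, ENNReal.ofReal (l ^ q) * (ENNReal.ofReal K +
          ENNReal.ofReal B * ∫⁻ y in Ω, ENNReal.ofReal (G x y)) :=
        setLIntegral_mono' hΩm hinner
    _ = ENNReal.ofReal (l ^ q) * (ENNReal.ofReal K * volume Ω +
          ENNReal.ofReal B * fracModular N Φ s Ω (fun x => u x / l)) := by
        rw [lintegral_const_mul' _ _ ofReal_ne_top, lintegral_add_left measurable_const,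
          lintegral_const_mul' _ _ ofReal_ne_top, setLIntegral_const]
        rfl
    _ ≤ ENNReal.ofReal (l ^ q) * (ENNReal.ofReal K * volume Ω + ENNReal.ofReal B * 1) := by
        gcongr
    _ = _ := by
        rw [ENNReal.ofReal_mul (p := l ^ q) (by positivity),
          ENNReal.ofReal_add (by positivity) hB0, ENNReal.ofReal_mul hK0, ENNReal.ofReal_toReal hΩ, mul_one]

end Modulars

/-- for `Ω ⊂ ℝᴺ` bounded open, `0 < s' < s < 1`, under the uniform index
condition together with `sup_{(x,y)} Φ_{x,y}(1) < ∞` and `inf_{(x,y)} Φ_{x,y}(1) > 0`,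
`W^sL_{Φ_{x,y}}(Ω)` embeds continuously into `W^{s',q}(Ω)` for every `q ∈ [1, φ⁻]`. -/
theorem embedding_into_classical (N : ℕ)
    (φ Φ : EuclideanSpace ℝ (Fin N) → EuclideanSpace ℝ (Fin N) → ℝ → ℝ)
    (φm φp s s' : ℝ) (hs'0 : 0 < s') (hs's : s' < s) (hs1 : s < 1)
    (Ω : Set (EuclideanSpace ℝ (Fin N))) (hΩo : IsOpen Ω) (hΩb : Bornology.IsBounded Ω)
    (hmono : ∀ x y, StrictMono (φ x y)) (hcont : ∀ x y, Continuous (φ x y))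
    (hsurj : ∀ x y, Function.Surjective (φ x y)) (hφ0 : ∀ x y, φ x y 0 = 0)
    (hΦ : ∀ x y t, Φ x y t = ∫ τ in (0:ℝ)..t, φ x y τ)
    (h1 : 1 < φm) (hmp : φm ≤ φp)
    (hidx : ∀ x y t, 0 < t → φm ≤ t * φ x y t / Φ x y t ∧ t * φ x y t / Φ x y t ≤ φp)
    (hbd : ∃ C : ℝ, ∀ x y, Φ x y 1 ≤ C)
    (hpos : ∃ c : ℝ, 0 < c ∧ ∀ x y, c ≤ Φ x y 1) :
    ∀ q : ℝ, 1 ≤ q → q ≤ φm →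
      ∃ c : ℝ, 0 < c ∧ ∀ u : EuclideanSpace ℝ (Fin N) → ℝ, memW N Φ s Ω u →
        classicalFracNorm N s' q Ω u ≤
          ENNReal.ofReal (c * (luxNorm N Φ Ω u + fracSeminorm N Φ s Ω u)) := by
  intro q hq hqm
  obtain ⟨c, hc0, hc⟩ := hpos
  have hdiv : ∀ x y t k, 0 ≤ t → 1 ≤ k → Φ x y (t / k) ≤ k⁻¹ * Φ x y t := fun x y t k ht hk =>
    primitive_div_le (hmono x y) (hφ0 x y) (hcont x y) (hΦ x y)
      (fun t ht => h1.le.trans (hidx x y t ht).1) ht hk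
  have hnn : ∀ x y t, 0 ≤ t → 0 ≤ Φ x y t := fun x y t ht =>
    primitive_nonneg (hmono x y) (hφ0 x y) (hcont x y) (hΦ x y) ht
  have hgrow : ∀ x y t, 0 ≤ t → t ^ q ≤ 1 + c⁻¹ * Φ x y t := fun x y t ht =>
    rpow_le_one_add_primitive (hmono x y) (hφ0 x y) (hcont x y) (hΦ x y) (by linarith)
      (fun t ht => hqm.trans (hidx x y t ht).1) hc0 (hc x y) ht
  have hvol : volume Ω ≠ ⊤ := hΩb.measure_lt_top.ne
  obtain ⟨D, hD0, hD⟩ : ∃ D : ℝ, 0 < D ∧ ∀ x ∈ Ω, ∀ y ∈ Ω, ‖x - y‖ < D := by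
    obtain ⟨R, hR⟩ := Metric.isBounded_iff.1 hΩb
    refine ⟨max R 0 + 1, by positivity, fun x hx y hy => ?_⟩
    rw [← dist_eq_norm]
    linarith [hR hx hy, le_max_left R 0]
  obtain ⟨K, hK0, hK⟩ := exists_setLIntegral_kernel_le N
    (mul_pos (sub_pos.2 hs's) (by linarith : 0 < q)) hD0 hD
  set A₁ := (volume Ω).toReal + c⁻¹
  set A₂ := K * (volume Ω).toReal + D ^ ((s - s') * q) * c⁻¹
  have hA₁ : 0 < A₁ := by positivity
  have hA₂ : 0 < A₂ := by positivity
  refine ⟨max (A₁ ^ (1 / q)) (A₂ ^ (1 / q)), by positivity, fun u hu => ?_⟩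
  obtain ⟨-, ⟨l₁, hl₁, hfin₁⟩, l₂, hl₂, hfin₂⟩ := hu
  have hlux := ofReal_le_mul_sInf (exists_luxModular_le_one hdiv hl₁ hfin₁)
    (Real.rpow_pos_of_pos hA₁ (1 / q)) (fun l hl => hl.1) fun l hl =>
      rpow_inv_le_of_le_rpow_mul hq hl.1 hA₁.le
        (lintegral_rpow_le_of_luxModular_le_one hvol hc0 hl.1 hnn hgrow hl.2)
  have hfrac := ofReal_le_mul_sInf (exists_fracModular_le_one hdiv hl₂ hfin₂)
    (Real.rpow_pos_of_pos hA₂ (1 / q)) (fun l hl => hl.1) fun l hl =>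
      rpow_inv_le_of_le_rpow_mul hq hl.1 hA₂.le
        (lintegral_gagliardo_le_of_fracModular_le_one hΩo.measurableSet hvol hq hs's hc0 hl.1
          hD0 hD hK0 hK hnn hgrow hl.2)
  have hlux0 : 0 ≤ luxNorm N Φ Ω u := Real.sInf_nonneg fun l hl => hl.1.le
  have hfrac0 : 0 ≤ fracSeminorm N Φ s Ω u := Real.sInf_nonneg fun l hl => hl.1.le
  rw [mul_add, ENNReal.ofReal_add (by positivity) (by positivity)]
  refine add_le_add (hlux.trans ?_) (hfrac.trans ?_)
  · exact ENNReal.ofReal_le_ofReal (mul_le_mul_of_nonneg_right (le_max_left _ _) hlux0)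
  · exact ENNReal.ofReal_le_ofReal (mul_le_mul_of_nonneg_right (le_max_right _ _) hfrac0)
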